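/- arXiv:1803.05756 — 4 statements merged into one kernel-verified Lean document; each statement's English description precedes it below -/
import Mathlib

section
/- Let p ≥ 0 and let t = (t_1, …, t_{N+p+1}) be a knot vector of degree p of length N + p + 1 (so t is nondecreasing and t_i < t_{i+p+1} for all i). Then the B-splines of degree p over t form a partition of unity on the interval [t_{p+1}, t_{N+1}): for every x with t_{p+1} ≤ x < t_{N+1}, the sum of B_{i,p}(x) for i = 1, …, N equals 1. -/
/-- The Cox–de Boor recursion defining the B-spline `B_{i,p}` of degree `p` with
index `i` over the knot sequence `t` (0-indexed): `bspline t i p` uses the knots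
`t i, …, t (i+p+1)`.  Any term whose denominator vanishes is automatically `0`
since division by zero is `0` in Lean. -/
noncomputable def bspline (t : ℕ → ℝ) : ℕ → ℕ → ℝ → ℝ
  | i, 0, x => if t i ≤ x ∧ x < t (i + 1) then 1 else 0
  | i, p + 1, x =>
      (x - t i) / (t (i + p + 1) - t i) * bspline t i p x +
        (t (i + p + 2) - x) / (t (i + p + 2) - t (i + 1)) * bspline t (i + 1) p x

/-- A B-spline vanishes outside the half-open interval spanned by its knots. -/
theorem bspline_eq_zero (t : ℕ → ℝ) (x : ℝ) (p i : ℕ)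
    (hmono : ∀ j k, j ≤ k → k ≤ i + p + 1 → t j ≤ t k)
    (hx : x < t i ∨ t (i + p + 1) ≤ x) : bspline t i p x = 0 := by
  induction p generalizing i with
  | zero =>
    rw [bspline, if_neg]
    rintro ⟨h₁, h₂⟩
    rcases hx with h | h
    · exact h₁.not_gt h
    · exact h₂.not_ge h
  | succ p ih =>
    have hleft : bspline t i p x = 0 := by
      refine ih i (fun j k hjk hk => hmono j k hjk (by omega)) (hx.imp_right fun h => ?_)
      exact (hmono _ _ (by omega) (by omega)).trans h
    have hright : bspline t (i + 1) p x = 0 := by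
      refine ih (i + 1) (fun j k hjk hk => hmono j k hjk (by omega))
        (hx.imp (fun h => ?_) fun h => ?_)
      · exact h.trans_le (hmono _ _ (by omega) (by omega))
      · exact (hmono _ _ (by omega) (by omega)).trans h
    rw [bspline, hleft, hright, mul_zero, mul_zero, add_zero]

/-- The two Cox–de Boor weights attached to a B-spline add up to one. -/
theorem bspline_weight_mul (t : ℕ → ℝ) (x : ℝ) (p i : ℕ)
    (hmono : ∀ j k, j ≤ k → k ≤ i + p + 1 → t j ≤ t k) :
    (t (i + p + 1) - x) / (t (i + p + 1) - t i) * bspline t i p x =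
      bspline t i p x - (x - t i) / (t (i + p + 1) - t i) * bspline t i p x := by
  by_cases h : t (i + p + 1) - t i = 0
  · have hx : x < t i ∨ t (i + p + 1) ≤ x := by
      rw [sub_eq_zero.mp h]
      exact lt_or_ge x (t i)
    simp [bspline_eq_zero t x p i hmono hx]
  · field_simp
    ring

theorem sum_bspline_zero (t : ℕ → ℝ) (x : ℝ) (N : ℕ)
    (hmono : ∀ i j, i ≤ j → j ≤ N → t i ≤ t j) (hx1 : t 0 ≤ x) (hx2 : x < t N) :
    ∑ i ∈ Finset.range N, bspline t i 0 x = 1 := by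
  induction N with
  | zero => exact absurd hx1 hx2.not_ge
  | succ N ih =>
    rw [Finset.sum_range_succ]
    by_cases h : x < t N
    · rw [ih (fun i j hij hj => hmono i j hij (by omega)) h, bspline,
        if_neg fun h' => h'.1.not_gt h, add_zero]
    · rw [not_lt] at h
      rw [bspline, if_pos ⟨h, hx2⟩, Finset.sum_eq_zero, zero_add]
      intro i hi
      have hi' := Finset.mem_range.mp hi
      exact bspline_eq_zero t x 0 i (fun j k hjk hk => hmono j k hjk (by omega))
        (Or.inr ((hmono _ _ (by omega) (by omega)).trans h))

/-- The partition of unity property needs only monotonicity of the knots. -/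
theorem sum_bspline_eq_one (t : ℕ → ℝ) (x : ℝ) (p N : ℕ)
    (hmono : ∀ i j, i ≤ j → j ≤ N + p → t i ≤ t j) (hx1 : t p ≤ x) (hx2 : x < t N) :
    ∑ i ∈ Finset.range N, bspline t i p x = 1 := by
  induction p with
  | zero => exact sum_bspline_zero t x N hmono hx1 hx2
  | succ p ih =>
    have hprev := ih (fun i j hij hj => hmono i j hij (by omega))
      ((hmono _ _ (by omega) (by omega)).trans hx1)
    have hfirst : bspline t 0 p x = 0 :=
      bspline_eq_zero t x p 0 (fun j k hjk hk => hmono j k hjk (by omega))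
        (Or.inr (by simpa using hx1))
    have hlast : bspline t N p x = 0 :=
      bspline_eq_zero t x p N (fun j k hjk hk => hmono j k hjk (by omega)) (Or.inl hx2)
    let w : ℕ → ℝ := fun i => (x - t i) / (t (i + p + 1) - t i) * bspline t i p x
    have hterm : ∀ i ∈ Finset.range N, bspline t i (p + 1) x =
        bspline t i p x + ((bspline t (i + 1) p x - w (i + 1)) - (bspline t i p x - w i)) := by
      intro i hi
      have hi' := Finset.mem_range.mp hi
      have hw := bspline_weight_mul t x p (i + 1)
        (fun j k hjk hk => hmono j k hjk (by omega))
      rw [show i + 1 + p + 1 = i + p + 2 by omega] at hw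
      rw [bspline, hw]
      simp only [w, show i + 1 + p + 1 = i + p + 2 by omega]
      ring
    rw [Finset.sum_congr rfl hterm, Finset.sum_add_distrib,
      Finset.sum_range_sub fun i => bspline t i p x - w i, hprev]
    simp [w, hfirst, hlast]

/-- for a knot vector `t = (t_0, …, t_{N+p})` of degree `p`
(nondecreasing, with `t_i < t_{i+p+1}` for all `i < N`), the `N` B-splines of
degree `p` form a partition of unity on `[t_p, t_N)` (which, in the paper's
1-based indexing, is `[t_{p+1}, t_{N+1})`). -/
theorem bspline_partition_of_unity (p N : ℕ) (t : ℕ → ℝ)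
    (hmono : ∀ i j, i ≤ j → j ≤ N + p → t i ≤ t j)
    (hknot : ∀ i, i < N → t i < t (i + p + 1))
    (x : ℝ) (hx1 : t p ≤ x) (hx2 : x < t N) :
    ∑ i ∈ Finset.range N, bspline t i p x = 1 := by
  exact sum_bspline_eq_one t x p N hmono hx1 hx2
end

section
/- Let p ≥ 1 and let t_i ≤ t_{i+1} ≤ … ≤ t_{i+p+1} be knots with t_i < t_{i+p+1}. Let 1 ≤ m ≤ p and suppose every real value occurs at most m times among t_i, …, t_{i+p+1} (i.e., every knot has multiplicity at most m). Then the B-spline B_{i,p} is (p − m)-times continuously differentiable on all of ℝ; in particular, if all knots t_i, …, t_{i+p+1} are pairwise distinct, then B_{i,p} is of class C^{p−1} on ℝ. -/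
theorem bspline_zero_apply (t : ℕ → ℝ) (i : ℕ) (x : ℝ) :
    bspline t i 0 x = if t i ≤ x ∧ x < t (i + 1) then 1 else 0 := rfl

theorem bspline_succ_apply (t : ℕ → ℝ) (i p : ℕ) (x : ℝ) :
    bspline t i (p + 1) x = (x - t i) / (t (i + p + 1) - t i) * bspline t i p x +
      (t (i + p + 2) - x) / (t (i + p + 2) - t (i + 1)) * bspline t (i + 1) p x := rfl

theorem bspline_zero_hasDerivWithinAt_Ioi (t : ℕ → ℝ) (i : ℕ) (x : ℝ) :
    HasDerivWithinAt (bspline t i 0) 0 (Set.Ioi x) x := by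
  have hev : ∀ a : ℝ, ∀ᶠ y in nhdsWithin x (Set.Ioi x), (a ≤ y ↔ a ≤ x) := by
    intro a
    rcases le_or_gt a x with h | h
    · filter_upwards [self_mem_nhdsWithin] with y hy
      exact iff_of_true (h.trans (le_of_lt hy)) h
    · filter_upwards [mem_nhdsWithin_of_mem_nhds (Iio_mem_nhds h)] with y hy
      exact iff_of_false (not_le.2 hy) (not_le.2 h)
  refine (hasDerivWithinAt_const x (Set.Ioi x) (bspline t i 0 x)).congr_of_eventuallyEq ?_ rfl
  filter_upwards [hev (t i), hev (t (i + 1))] with y h1 h2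
  simp only [bspline_zero_apply, h1, ← not_le, h2]

/-- The right derivative of a B-spline is given at every point by the usual two-term formula. -/
theorem bspline_succ_hasDerivWithinAt_Ioi (t : ℕ → ℝ) (p i : ℕ)
    (ht : MonotoneOn t (Set.Icc i (i + p + 2))) (x : ℝ) :
    HasDerivWithinAt (bspline t i (p + 1))
      ((p + 1) * (bspline t i p x / (t (i + p + 1) - t i) -
        bspline t (i + 1) p x / (t (i + p + 2) - t (i + 1)))) (Set.Ioi x) x := by
  have product {f g : ℝ → ℝ} {f' g' : ℝ} (a b c d : ℝ)
      (hf : HasDerivWithinAt f f' (Set.Ioi x) x) (hg : HasDerivWithinAt g g' (Set.Ioi x) x) :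
      HasDerivWithinAt (fun y => (y - a) / c * f y + (b - y) / d * g y)
        (1 / c * f x + (x - a) / c * f' + (-1 / d * g x + (b - x) / d * g')) (Set.Ioi x) x :=
    ((((hasDerivWithinAt_id x _).sub_const a).div_const c).mul hf).add
      ((((hasDerivWithinAt_id x _).const_sub b).div_const d).mul hg)
  induction p generalizing i with
  | zero =>
    refine (product (t i) (t (i + 2)) (t (i + 1) - t i) (t (i + 2) - t (i + 1))
      (bspline_zero_hasDerivWithinAt_Ioi t i x)
      (bspline_zero_hasDerivWithinAt_Ioi t (i + 1) x)).congr_deriv ?_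
    push_cast
    ring
  | succ p ih =>
    have h1 := ih i (ht.mono (Set.Icc_subset_Icc le_rfl (by omega)))
    have h2 := ih (i + 1) (ht.mono (Set.Icc_subset_Icc (by omega) (by omega)))
    have e1 : i + 1 + p + 1 = i + p + 2 := by omega
    have e2 : i + 1 + p + 2 = i + p + 3 := by omega
    have e3 : i + (p + 1) + 1 = i + p + 2 := by omega
    have e4 : i + (p + 1) + 2 = i + p + 3 := by omega
    rw [e1, e2] at h2
    rw [e3, e4]
    have hfun : bspline t i (p + 1 + 1) = fun y =>
        (y - t i) / (t (i + p + 2) - t i) * bspline t i (p + 1) y +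
        (t (i + p + 3) - y) / (t (i + p + 3) - t (i + 1)) * bspline t (i + 1) (p + 1) y := rfl
    rw [hfun]
    convert product (t i) (t (i + p + 3)) (t (i + p + 2) - t i) (t (i + p + 3) - t (i + 1))
      h1 h2 using 1
    have le {j k : ℕ} (hj : i ≤ j) (hjk : j ≤ k) (hk : k ≤ i + p + 3) : t j ≤ t k :=
      ht ⟨hj, by omega⟩ ⟨by omega, by omega⟩ hjk
    have l1 : t i ≤ t (i + 1) := le (by omega) (by omega) (by omega)
    have l2 : t (i + 1) ≤ t (i + p + 2) := le (by omega) (by omega) (by omega)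
    have l3 : t (i + p + 2) ≤ t (i + p + 3) := le (by omega) (by omega) (by omega)
    rw [bspline_succ_apply t i p, bspline_succ_apply t (i + 1) p, e1, e2]
    push_cast
    rcases l2.eq_or_lt with h | h
    · rw [h]
      simp only [sub_self, div_zero]
      ring
    · have n1 : t (i + p + 2) - t i ≠ 0 := by linarith
      have n2 : t (i + p + 3) - t (i + 1) ≠ 0 := by linarith
      have n3 : t (i + p + 2) - t (i + 1) ≠ 0 := by linarith
      simp only [div_mul_eq_mul_div, mul_div_assoc]
      generalize bspline t i p x / (t (i + p + 1) - t i) = a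
      generalize bspline t (i + 1 + 1) p x / (t (i + p + 3) - t (i + 1 + 1)) = c
      field_simp
      ring

/-- The jump of a B-spline at a point is determined by which of its `p + 1` first and `p + 1` last
knots coincide there. -/
theorem bspline_tendsto_nhdsLT (t : ℕ → ℝ) (p i : ℕ)
    (ht : MonotoneOn t (Set.Icc i (i + p + 1))) (x : ℝ) :
    Filter.Tendsto (bspline t i p) (nhdsWithin x (Set.Iio x))
      (nhds (bspline t i p x - ((if t i = x ∧ t (i + p) = x then 1 else 0) -
        (if t (i + 1) = x ∧ t (i + p + 1) = x then 1 else 0)))) := by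
  induction p generalizing i with
  | zero =>
    have hev : ∀ a : ℝ, ∀ᶠ y in nhdsWithin x (Set.Iio x), (a ≤ y ↔ a < x) := by
      intro a
      rcases lt_or_ge a x with h | h
      · filter_upwards [mem_nhdsWithin_of_mem_nhds (Ioi_mem_nhds h)] with y hy
        exact iff_of_true (le_of_lt hy) h
      · filter_upwards [self_mem_nhdsWithin] with y hy
        exact iff_of_false (not_le.2 (lt_of_lt_of_le hy h)) (not_lt.2 h)
    refine tendsto_const_nhds.congr' ?_
    filter_upwards [hev (t i), hev (t (i + 1))] with y h1 h2
    have hle : t i ≤ t (i + 1) := ht ⟨by omega, by omega⟩ ⟨by omega, by omega⟩ (by omega)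
    simp only [bspline_zero_apply, h1, ← not_le (a := t (i + 1)), h2, add_zero, and_self]
    rcases lt_trichotomy (t i) x with h | h | h <;>
      rcases lt_trichotomy (t (i + 1)) x with h' | h' | h' <;>
      grind
  | succ p ih =>
    have h1 := ih i (ht.mono (Set.Icc_subset_Icc le_rfl (by omega)))
    have h2 := ih (i + 1) (ht.mono (Set.Icc_subset_Icc (by omega) (by omega)))
    have hid : Filter.Tendsto (fun y : ℝ => y) (nhdsWithin x (Set.Iio x)) (nhds x) :=
      tendsto_nhdsWithin_of_tendsto_nhds Filter.tendsto_id
    have e0 : i + 1 + p = i + p + 1 := by omega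
    have e1 : i + 1 + p + 1 = i + p + 2 := by omega
    have e3 : i + (p + 1) + 1 = i + p + 2 := by omega
    have e4 : i + (p + 1) = i + p + 1 := by omega
    rw [e1, e0] at h2
    rw [e3, e4]
    convert (((hid.sub_const (t i)).div_const (t (i + p + 1) - t i)).mul h1).add
      (((hid.const_sub (t (i + p + 2))).div_const (t (i + p + 2) - t (i + 1))).mul h2) using 2
    · rfl
    have le {j k : ℕ} (hj : i ≤ j) (hjk : j ≤ k) (hk : k ≤ i + p + 2) : t j ≤ t k :=
      ht ⟨hj, by omega⟩ ⟨by omega, by omega⟩ hjk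
    have l1 : t i ≤ t (i + 1) := le (by omega) (by omega) (by omega)
    have l2 : t (i + 1) ≤ t (i + p + 1) := le (by omega) (by omega) (by omega)
    have l3 : t (i + p + 1) ≤ t (i + p + 2) := le (by omega) (by omega) (by omega)
    have first : (x - t i) / (t (i + p + 1) - t i) *
        (if t i = x ∧ t (i + p) = x then (1 : ℝ) else 0) = 0 := by
      split_ifs with h
      · simp [h.1]
      · simp
    have last : (t (i + p + 2) - x) / (t (i + p + 2) - t (i + 1)) *
        (if t (i + 1 + 1) = x ∧ t (i + p + 2) = x then (1 : ℝ) else 0) = 0 := by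
      split_ifs with h
      · simp [h.2]
      · simp
    have middle : (if t i = x ∧ t (i + p + 1) = x then (1 : ℝ) else 0) -
        (if t (i + 1) = x ∧ t (i + p + 2) = x then (1 : ℝ) else 0) =
        ((t (i + p + 2) - x) / (t (i + p + 2) - t (i + 1)) -
          (x - t i) / (t (i + p + 1) - t i)) *
        (if t (i + 1) = x ∧ t (i + p + 1) = x then (1 : ℝ) else 0) := by
      by_cases h : t (i + 1) = x ∧ t (i + p + 1) = x
      · obtain ⟨ha, hb⟩ := h
        have ratio (a b : ℝ) : (a - b) / (a - b) = if b = a then 0 else 1 := by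
          split_ifs with hab
          · simp [hab]
          · exact div_self (sub_ne_zero.2 (Ne.symm hab))
        simp only [ha, hb, ratio, and_true, true_and, if_true, mul_one]
        split_ifs <;> grind
      · rw [if_neg h, if_neg (by grind), if_neg (by grind)]
        simp
    rw [bspline_succ_apply, middle]
    linear_combination first - last

theorem bspline_continuous (t : ℕ → ℝ) (p i : ℕ) (hp : 1 ≤ p)
    (ht : MonotoneOn t (Set.Icc i (i + p + 1)))
    (h0 : t i < t (i + p)) (h1 : t (i + 1) < t (i + p + 1)) :
    Continuous (bspline t i p) := by
  rw [continuous_iff_continuousAt]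
  intro x
  rw [continuousAt_iff_continuous_left'_right']
  constructor
  · have h := bspline_tendsto_nhdsLT t p i ht x
    rw [if_neg (by grind), if_neg (by grind)] at h
    simpa [ContinuousWithinAt] using h
  · obtain ⟨q, rfl⟩ := Nat.exists_eq_add_of_le' hp
    exact (bspline_succ_hasDerivWithinAt_Ioi t q i ht x).continuousWithinAt

theorem hasDerivAt_of_continuous_of_hasDerivWithinAt_Ioi {f f' : ℝ → ℝ} (hf : Continuous f)
    (hf' : Continuous f') (h : ∀ x, HasDerivWithinAt f (f' x) (Set.Ioi x) x) (x : ℝ) :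
    HasDerivAt f (f' x) x := by
  have heq : f = fun y => (∫ z in (0 : ℝ)..y, f' z) + f 0 := by
    funext y
    rw [intervalIntegral.integral_eq_sub_of_hasDeriv_right hf.continuousOn (fun z _ => h z)
      (hf'.intervalIntegrable 0 y)]
    ring
  rw [heq]
  exact (hf'.integral_hasStrictDerivAt 0 x).hasDerivAt.add_const _

theorem bspline_contDiff_of_lt_add (t : ℕ → ℝ) (m n i : ℕ) (hm : 1 ≤ m)
    (ht : MonotoneOn t (Set.Icc i (i + (n + m) + 1)))
    (hlt : ∀ j, i ≤ j → j + m ≤ i + (n + m) + 1 → t j < t (j + m)) :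
    ContDiff ℝ n (bspline t i (n + m)) := by
  have hcont : Continuous (bspline t i (n + m)) := by
    refine bspline_continuous t (n + m) i (by omega) ht ?_ ?_
    · exact (hlt i le_rfl (by omega)).trans_le
        (ht ⟨by omega, by omega⟩ ⟨by omega, by omega⟩ (by omega))
    · exact (hlt (i + 1) (by omega) (by omega)).trans_le
        (ht ⟨by omega, by omega⟩ ⟨by omega, by omega⟩ (by omega))
  induction n generalizing i with
  | zero => exact_mod_cast contDiff_zero.2 hcont
  | succ n ih =>
    have restrict (k : ℕ) (hk : i ≤ k) (hk' : k ≤ i + 1) :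
        ContDiff ℝ n (bspline t k (n + m)) := by
      have ht' : MonotoneOn t (Set.Icc k (k + (n + m) + 1)) :=
        ht.mono (Set.Icc_subset_Icc hk (by omega))
      refine ih k ht' (fun j h1 h2 => hlt j (by omega) (by omega)) ?_
      refine bspline_continuous t (n + m) k (by omega) ht' ?_ ?_
      · exact (hlt k (by omega) (by omega)).trans_le
          (ht ⟨by omega, by omega⟩ ⟨by omega, by omega⟩ (by omega))
      · exact (hlt (k + 1) (by omega) (by omega)).trans_le
          (ht ⟨by omega, by omega⟩ ⟨by omega, by omega⟩ (by omega))
    have e : n + 1 + m = n + m + 1 := by omega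
    rw [e] at hcont ht ⊢
    have hG := (contDiff_const (𝕜 := ℝ) (c := ((n + m : ℕ) : ℝ) + 1)).mul
      (((restrict i le_rfl (by omega)).div_const (t (i + (n + m) + 1) - t i)).sub
        ((restrict (i + 1) (by omega) le_rfl).div_const (t (i + (n + m) + 2) - t (i + 1))))
    have hderiv := hasDerivAt_of_continuous_of_hasDerivWithinAt_Ioi hcont hG.continuous
      (bspline_succ_hasDerivWithinAt_Ioi t (n + m) i ht)
    push_cast
    rw [contDiff_succ_iff_deriv]
    refine ⟨fun x => (hderiv x).differentiableAt, by simp, ?_⟩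
    rwa [funext fun x => (hderiv x).deriv]

/-- if `p ≥ 1`, the knots `t_i ≤ … ≤ t_{i+p+1}` satisfy
`t_i < t_{i+p+1}`, and every real value occurs at most `m` times among
`t_i, …, t_{i+p+1}` (with `1 ≤ m ≤ p`), then `B_{i,p}` is `(p - m)`-times
continuously differentiable on all of `ℝ`; in particular, if the knots
`t_i, …, t_{i+p+1}` are pairwise distinct, then `B_{i,p}` is of class
`C^{p-1}` on `ℝ`. -/
theorem bspline_contDiff (t : ℕ → ℝ) (i p m : ℕ) (hp : 1 ≤ p)
    (hmono : ∀ j, j < p + 1 → t (i + j) ≤ t (i + j + 1))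
    (hlt : t i < t (i + p + 1))
    (hm1 : 1 ≤ m) (hm2 : m ≤ p)
    (hmult : ∀ v : ℝ, ((Finset.range (p + 2)).filter (fun j => t (i + j) = v)).card ≤ m) :
    ContDiff ℝ ((p - m : ℕ) : ℕ∞) (fun x => bspline t i p x) ∧
      ((∀ j k, j < k → k < p + 2 → t (i + j) < t (i + k)) →
        ContDiff ℝ ((p - 1 : ℕ) : ℕ∞) (fun x => bspline t i p x)) := by
  have ht : MonotoneOn t (Set.Icc i (i + p + 1)) := by
    have key (j k : ℕ) (hk : j + k < p + 2) : t (i + j) ≤ t (i + (j + k)) := by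
      induction k with
      | zero => rfl
      | succ k ih => exact (ih (by omega)).trans (hmono (j + k) (by omega))
    intro a ha b hb hab
    obtain ⟨j, rfl⟩ := Nat.exists_eq_add_of_le ha.1
    obtain ⟨k, rfl⟩ := Nat.exists_eq_add_of_le hab
    have := hb.2
    simpa only [add_assoc] using key j k (by omega)
  constructor
  · obtain ⟨n, rfl⟩ := Nat.exists_eq_add_of_le' hm2
    rw [Nat.add_sub_cancel]
    refine bspline_contDiff_of_lt_add t m n i hm1 ht fun j hj hjm => ?_
    by_contra! hle
    have hsub : Finset.Icc (j - i) (j - i + m) ⊆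
        (Finset.range (n + m + 2)).filter (fun k => t (i + k) = t j) := by
      intro k hk
      rw [Finset.mem_Icc] at hk
      rw [Finset.mem_filter, Finset.mem_range]
      refine ⟨by omega, le_antisymm (le_trans ?_ hle) ?_⟩ <;>
        exact ht ⟨by omega, by omega⟩ ⟨by omega, by omega⟩ (by omega)
    have hcard := (Finset.card_le_card hsub).trans (hmult (t j))
    rw [Nat.card_Icc] at hcard
    omega
  · intro hstrict
    obtain ⟨n, rfl⟩ := Nat.exists_eq_add_of_le' hp
    rw [Nat.add_sub_cancel]
    refine bspline_contDiff_of_lt_add t 1 n i le_rfl ht fun j hj hjm => ?_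
    obtain ⟨k, rfl⟩ := Nat.exists_eq_add_of_le hj
    exact hstrict k (k + 1) (by omega) (by omega)
end

section
/- Let p ≥ 0 and let τ_1 ≤ τ_2 ≤ … ≤ τ_{p+2} be the knots of a single B-spline B[τ] of degree p, with τ_1 < τ_{p+2}. Let x̂ be a real number with τ_1 ≤ x̂ ≤ τ_{p+2}, and let τ' = (τ'_1, …, τ'_{p+3}) be the nondecreasing sequence obtained from τ by inserting x̂. Then there exist α, β ∈ [0, 1] such that for every real x, B[τ_1, …, τ_{p+2}](x) = α·B[τ'_1, …, τ'_{p+2}](x) + β·B[τ'_2, …, τ'_{p+3}](x); that is, inserting one knot expresses a B-spline as a nonnegative combination of the two B-splines over consecutive windows of the refined knot sequence. -/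
theorem bspline_congr {s t : ℕ → ℝ} {i i' p : ℕ}
    (h : ∀ j ≤ p + 1, s (i + j) = t (i' + j)) (x : ℝ) :
    bspline s i p x = bspline t i' p x := by
  induction p generalizing i i' with
  | zero =>
    have h0 := h 0 (by omega)
    have h1 := h 1 (by omega)
    simp only [add_zero] at h0
    simp only [bspline, h0, h1]
  | succ p ih =>
    have h0 := h 0 (by omega)
    have h1 := h 1 (by omega)
    have h2 := h (p + 1) (by omega)
    have h3 := h (p + 2) (by omega)
    simp only [add_zero, ← add_assoc] at h0 h1 h2 h3
    have hl : bspline s i p x = bspline t i' p x := ih fun j hj => h j (by omega)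
    have hr : bspline s (i + 1) p x = bspline t (i' + 1) p x := ih fun j hj => by
      simpa [add_assoc, add_comm 1 j] using h (j + 1) (by omega)
    simp only [bspline, h0, h1, h2, h3, hl, hr]

/-- Boehm's knot insertion formula: `s` is obtained from `t` by deleting the knot `t k`, which is
not the first or the last knot of the window `t i, …, t (i + p + 2)`. -/
theorem bspline_eq_of_knot_deletion {s t : ℕ → ℝ} {k N : ℕ}
    (ht : MonotoneOn t (Set.Iic (N + 1)))
    (hs : ∀ j < k, s j = t j) (hs' : ∀ j, k ≤ j → j ≤ N → s j = t (j + 1))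
    {i p : ℕ} (hik : i + 1 ≤ k) (hki : k ≤ i + p + 1) (hN : i + p + 1 ≤ N) (x : ℝ) :
    bspline s i p x =
      (t k - t i) / (t (i + p + 1) - t i) * bspline t i p x +
        (t (i + p + 2) - t k) / (t (i + p + 2) - t (i + 1)) * bspline t (i + 1) p x := by
  have mono : ∀ m n, m ≤ n → n ≤ N + 1 → t m ≤ t n := fun m n hmn hn =>
    ht (Set.mem_Iic.2 (hmn.trans hn)) (Set.mem_Iic.2 hn) hmn
  induction p generalizing i with
  | zero =>
    obtain rfl : k = i + 1 := by omega
    have h1 := mono i (i + 1) (by omega) (by omega)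
    have h2 := mono (i + 1) (i + 2) (by omega) (by omega)
    have e1 := hs i (by omega)
    have e2 : s (i + 1) = t (i + 2) := hs' (i + 1) le_rfl (by omega)
    simp only [bspline, e1, e2, add_zero, add_assoc, Nat.reduceAdd]
    rcases h1.eq_or_lt with h1 | h1 <;> rcases h2.eq_or_lt with h2 | h2
    · simp [h1, h2]
    · rw [h1, div_self (sub_pos.2 h2).ne']; simp
    · rw [← h2, div_self (sub_pos.2 h1).ne']; simp
    · rw [div_self (sub_pos.2 h2).ne', div_self (sub_pos.2 h1).ne']
      grind
  | succ p ih =>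
    have hab := mono i (i + 1) (by omega) (by omega)
    have hbc := mono (i + 1) (i + 2) (by omega) (by omega)
    have hbe := mono (i + 1) (i + p + 2) (by omega) (by omega)
    have hcf := mono (i + 2) (i + p + 3) (by omega) (by omega)
    have had := mono i (i + p + 1) (by omega) (by omega)
    have hde := mono (i + p + 1) (i + p + 2) (by omega) (by omega)
    have hef := mono (i + p + 2) (i + p + 3) (by omega) (by omega)
    have e0 := hs i (by omega)
    have e3 : s (i + p + 2) = t (i + p + 3) := hs' (i + p + 2) (by omega) (by omega)
    have hleft : (x - s i) / (s (i + p + 1) - s i) * bspline s i p x =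
        (x - t i) / (t (i + p + 2) - t i) *
          ((t k - t i) / (t (i + p + 1) - t i) * bspline t i p x +
            (t (i + p + 2) - t k) / (t (i + p + 2) - t (i + 1)) * bspline t (i + 1) p x) := by
      rcases hki.lt_or_eq with h | h
      · rw [ih hik (by omega) (by omega), e0, hs' (i + p + 1) (by omega) (by omega)]
      · obtain rfl : k = i + p + 2 := by omega
        rw [e0, hs (i + p + 1) (by omega),
          bspline_congr (t := t) (i' := i) fun j hj => hs (i + j) (by omega)]
        rcases had.eq_or_lt with h1 | h1
        · simp [h1]
        · have := (sub_pos.2 (h1.trans_le hde)).ne'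
          have := (sub_pos.2 h1).ne'
          simp only [sub_self, zero_div, zero_mul, add_zero]
          field_simp
    have hright : (s (i + p + 2) - x) / (s (i + p + 2) - s (i + 1)) * bspline s (i + 1) p x =
        (t (i + p + 3) - x) / (t (i + p + 3) - t (i + 1)) *
          ((t k - t (i + 1)) / (t (i + p + 2) - t (i + 1)) * bspline t (i + 1) p x +
            (t (i + p + 3) - t k) / (t (i + p + 3) - t (i + 2)) * bspline t (i + 2) p x) := by
      rcases hik.lt_or_eq with h | h
      · rw [ih (i := i + 1) (by omega) (by omega) (by omega), e3, hs (i + 1) (by omega)]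
        simp only [show i + 1 + p + 1 = i + p + 2 by omega, show i + 1 + p + 2 = i + p + 3 by omega,
          add_assoc i 1 1, Nat.reduceAdd]
      · subst h
        have hc : bspline s (i + 1) p x = bspline t (i + 2) p x := bspline_congr (fun j hj => by
          rw [hs' (i + 1 + j) (by omega) (by omega)]; congr 1; omega) x
        have e1 : s (i + 1) = t (i + 2) := hs' (i + 1) le_rfl (by omega)
        rw [e3, e1, hc]
        rcases hcf.eq_or_lt with h1 | h1
        · simp [h1]
        · have := (sub_pos.2 (hbc.trans_lt h1)).ne'
          have := (sub_pos.2 h1).ne'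
          simp only [sub_self, zero_div, zero_mul, zero_add]
          field_simp
    simp only [bspline]
    rw [hleft, hright]
    simp only [show i + (p + 1) + 1 = i + p + 2 by omega, show i + (p + 1) + 2 = i + p + 3 by omega,
      show i + 1 + p + 1 = i + p + 2 by omega, show i + 1 + p + 2 = i + p + 3 by omega,
      add_assoc i 1 1, Nat.reduceAdd]
    rcases hbe.eq_or_lt with h | h
    · simp only [h, sub_self, div_zero, zero_mul, add_zero, zero_add]
      ring
    · have h1 := (sub_pos.2 (hab.trans_lt h)).ne'
      have h2 := (sub_pos.2 (h.trans_le hef)).ne'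
      have h3 := (sub_pos.2 h).ne'
      have key : (x - t i) / (t (i + p + 2) - t i) * (t (i + p + 2) - t k) +
          (t (i + p + 3) - x) / (t (i + p + 3) - t (i + 1)) * (t k - t (i + 1)) =
          (t k - t i) / (t (i + p + 2) - t i) * (t (i + p + 2) - x) +
          (t (i + p + 3) - t k) / (t (i + p + 3) - t (i + 1)) * (x - t (i + 1)) := by
        field_simp
        ring
      linear_combination (bspline t (i + 1) p x / (t (i + p + 2) - t (i + 1))) * key

/-- let `τ_0 ≤ … ≤ τ_{p+1}` (0-based) be the knots of a single
B-spline of degree `p` with `τ_0 < τ_{p+1}`, let `τ_0 ≤ xstar ≤ τ_{p+1}`, and let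
`τ'` be the nondecreasing sequence obtained from `τ` by inserting `xstar` (at
position `k`).  Then there exist `α, β ∈ [0,1]` such that
`B[τ_0,…,τ_{p+1}] = α·B[τ'_0,…,τ'_{p+1}] + β·B[τ'_1,…,τ'_{p+2}]` everywhere. -/
theorem bspline_single_knot_insertion (p : ℕ) (τ τ' : ℕ → ℝ) (xstar : ℝ) (k : ℕ)
    (hmono : ∀ j, j < p + 1 → τ j ≤ τ (j + 1))
    (hlt : τ 0 < τ (p + 1))
    (hx1 : τ 0 ≤ xstar) (hx2 : xstar ≤ τ (p + 1))
    (hk : k ≤ p + 1)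
    (hins1 : ∀ j, j < k → τ' j = τ j)
    (hins2 : τ' k = xstar)
    (hins3 : ∀ j, k ≤ j → j ≤ p + 1 → τ' (j + 1) = τ j)
    (hmono' : ∀ j, j < p + 2 → τ' j ≤ τ' (j + 1)) :
    ∃ α β : ℝ, α ∈ Set.Icc (0 : ℝ) 1 ∧ β ∈ Set.Icc (0 : ℝ) 1 ∧
      ∀ x : ℝ, bspline τ 0 p x = α * bspline τ' 0 p x + β * bspline τ' 1 p x := by
  have ht : MonotoneOn τ' (Set.Iic (p + 1 + 1)) := fun a _ b hb hab => by
    obtain ⟨n, rfl⟩ := Nat.exists_eq_add_of_le hab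
    have hb : a + n ≤ p + 2 := hb
    clear hab
    induction n with
    | zero => exact le_rfl
    | succ n ih =>
      exact (ih (Set.mem_Iic.2 (by omega)) (by omega)).trans (hmono' (a + n) (by omega))
  rcases k.eq_zero_or_pos with rfl | hk0
  · refine ⟨0, 1, by simp, by simp, fun x => ?_⟩
    have hc : bspline τ 0 p x = bspline τ' 1 p x := bspline_congr (fun j hj => by
      rw [zero_add, add_comm 1 j, hins3 j (Nat.zero_le j) hj]) x
    rw [hc]
    ring
  · have mono : ∀ m n, m ≤ n → n ≤ p + 2 → τ' m ≤ τ' n := fun m n hmn hn =>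
      ht (Set.mem_Iic.2 (hmn.trans hn)) (Set.mem_Iic.2 hn) hmn
    have h0 := mono 0 k (by omega) (by omega)
    have h1 := mono 1 k (by omega) (by omega)
    have h2 := mono k (p + 1) (by omega) (by omega)
    have h3 := mono k (p + 2) (by omega) (by omega)
    refine ⟨(τ' k - τ' 0) / (τ' (p + 1) - τ' 0), (τ' (p + 2) - τ' k) / (τ' (p + 2) - τ' 1),
      ⟨div_nonneg (by linarith) (by linarith), div_le_one_of_le₀ (by linarith) (by linarith)⟩,
      ⟨div_nonneg (by linarith) (by linarith), div_le_one_of_le₀ (by linarith) (by linarith)⟩,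
      fun x => ?_⟩
    simpa using bspline_eq_of_knot_deletion (s := τ) ht (fun j hj => (hins1 j hj).symm)
      (fun j hj hj' => (hins3 j hj hj').symm) (i := 0) (p := p) (by omega) (by omega) (by omega) x
end

section
/- Let p ≥ 0, let t = (t_1, …, t_{N+p+1}) be a knot vector of degree p (nondecreasing with t_i < t_{i+p+1} for all i), and let t' = (t'_1, …, t'_{N+p+2}) be the knot vector obtained from t by inserting one additional knot t* with t_{p+1} ≤ t* ≤ t_{N+1}, with corresponding B-splines B'_{1,p}, …, B'_{N+1,p}. Then the spline spaces are nested: for every choice of coefficients c_1, …, c_N ∈ ℝ there exist coefficients c'_1, …, c'_{N+1} ∈ ℝ such that Σ_{i=1}^N c_i B_{i,p}(x) = Σ_{j=1}^{N+1} c'_j B'_{j,p}(x) for all x ∈ [t_{p+1}, t_{N+1}). -/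
/-- A B-spline depends only on the knots `t i, …, t (i + p + 1)`, up to a shift of the index. -/
theorem bspline_congr_shift (t t' : ℕ → ℝ) (d p i : ℕ) (x : ℝ)
    (h : ∀ j, i ≤ j → j ≤ i + p + 1 → t' (j + d) = t j) :
    bspline t i p x = bspline t' (i + d) p x := by
  induction p generalizing i with
  | zero =>
    have h1 := h i (by omega) (by omega)
    have h2 := h (i + 1) (by omega) (by omega)
    rw [show i + 1 + d = i + d + 1 by omega] at h2
    simp only [bspline, h1, h2]
  | succ p ih =>
    have h1 := h i (by omega) (by omega)
    have h2 := h (i + 1) (by omega) (by omega)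
    have h3 := h (i + p + 1) (by omega) (by omega)
    have h4 := h (i + p + 2) (by omega) (by omega)
    have ih1 := ih i fun j hj hj' => h j hj (by omega)
    have ih2 := ih (i + 1) fun j hj hj' => h j (by omega) (by omega)
    rw [show i + 1 + d = i + d + 1 by omega] at h2 ih2
    rw [show i + p + 1 + d = i + d + p + 1 by omega] at h3
    rw [show i + p + 2 + d = i + d + p + 2 by omega] at h4
    simp only [bspline, h1, h2, h3, h4, ih1, ih2]

/-- Boehm's knot insertion identity: if `t'` arises from `t` by inserting a knot at a position `k`
inside the support of `B_{i,p}`, then `B_{i,p}` is an explicit combination of two consecutive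
refined B-splines. -/
theorem bspline_eq_of_insert_knot (t t' : ℕ → ℝ) (k M : ℕ)
    (hlt : ∀ j, j < k → t' j = t j)
    (hge : ∀ j, k ≤ j → j ≤ M → t' (j + 1) = t j)
    (hmono : ∀ i j, i ≤ j → j ≤ M + 1 → t' i ≤ t' j)
    (x : ℝ) (p i : ℕ) (hik : i < k) (hki : k ≤ i + p + 1) (hM : i + p + 1 ≤ M) :
    bspline t i p x =
      (t' k - t' i) / (t' (i + p + 1) - t' i) * bspline t' i p x +
        (t' (i + p + 2) - t' k) / (t' (i + p + 2) - t' (i + 1)) * bspline t' (i + 1) p x := by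
  induction p generalizing i with
  | zero =>
    obtain rfl : k = i + 1 := by omega
    have h0 := hlt i (by omega)
    have h1 := hge (i + 1) le_rfl (by omega)
    have m1 := hmono i (i + 1) (by omega) (by omega)
    have m2 := hmono (i + 1) (i + 1 + 1) (by omega) (by omega)
    simp only [bspline, ← h0, ← h1, add_zero]
    generalize t' i = a at *
    generalize t' (i + 1 + 1) = c at *
    generalize t' (i + 1) = s at *
    rcases lt_or_ge x s with hx | hx
    · by_cases ha : a ≤ x
      · have : s - a ≠ 0 := by linarith
        simp [ha, hx, hx.not_ge, hx.trans_le m2, this]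
      · simp [ha, hx.not_ge]
    · by_cases hc : x < c
      · have : c - s ≠ 0 := by linarith
        simp [hc, hx, hx.not_gt, m1.trans hx, this]
      · simp [hc, hx.not_gt]
  | succ p ih =>
    have ha := hlt i hik
    have he := hge (i + p + 2) (by omega) (by omega)
    have m1 := hmono i (i + 1) (by omega) (by omega)
    have m2 := hmono (i + 1) (i + 2) (by omega) (by omega)
    have m3 := hmono (i + 2) (i + p + 2) (by omega) (by omega)
    have m4 := hmono (i + p + 2) (i + p + 3) (by omega) (by omega)
    have m5 := hmono (i + p + 1) (i + p + 2) (by omega) (by omega)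
    have m6 := hmono i (i + p + 1) (by omega) (by omega)
    have left : (x - t i) / (t (i + p + 1) - t i) * bspline t i p x =
        (x - t' i) / (t' (i + p + 2) - t' i) *
          ((t' k - t' i) / (t' (i + p + 1) - t' i) * bspline t' i p x +
            (t' (i + p + 2) - t' k) / (t' (i + p + 2) - t' (i + 1)) *
              bspline t' (i + 1) p x) := by
      rcases (show k ≤ i + p + 1 ∨ k = i + p + 2 by omega) with hk | rfl
      · rw [ih i hik hk (by omega), ← ha, ← hge (i + p + 1) hk (by omega)]
      · rw [bspline_congr_shift t t' 0 p i x fun j _ _ => hlt j (by omega), ← ha,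
          ← hlt (i + p + 1) (by omega)]
        simp only [add_zero, sub_self, zero_div, zero_mul]
        by_cases h : t' (i + p + 2) - t' i = 0
        · have : t' (i + p + 1) - t' i = 0 := by linarith
          simp [h, this]
        · field_simp
    have right : (t (i + p + 2) - x) / (t (i + p + 2) - t (i + 1)) * bspline t (i + 1) p x =
        (t' (i + p + 3) - x) / (t' (i + p + 3) - t' (i + 1)) *
          ((t' k - t' (i + 1)) / (t' (i + p + 2) - t' (i + 1)) * bspline t' (i + 1) p x +
            (t' (i + p + 3) - t' k) / (t' (i + p + 3) - t' (i + 2)) *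
              bspline t' (i + 2) p x) := by
      rcases (show i + 1 < k ∨ k = i + 1 by omega) with hk | rfl
      · have := ih (i + 1) hk (by omega) (by omega)
        rw [show i + 1 + p + 1 = i + p + 2 by omega, show i + 1 + p + 2 = i + p + 3 by omega]
          at this
        rw [this, ← he, ← hlt (i + 1) hk]
      · rw [bspline_congr_shift t t' 1 p (i + 1) x fun j _ _ => hge j (by omega) (by omega), ← he,
          ← hge (i + 1) le_rfl (by omega)]
        simp only [sub_self, zero_div, zero_mul, zero_add]
        by_cases h : t' (i + p + 3) - t' (i + 1) = 0
        · have : t' (i + p + 3) - t' (i + 2) = 0 := by linarith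
          simp [h, this]
        · field_simp
    rw [bspline, left, right]
    simp only [bspline, show i + (p + 1) + 1 = i + p + 2 by omega,
      show i + (p + 1) + 2 = i + p + 3 by omega, show i + 1 + p + 1 = i + p + 2 by omega,
      show i + 1 + p + 2 = i + p + 3 by omega, show i + 1 + 1 = i + 2 by omega]
    by_cases h : t' (i + p + 2) - t' (i + 1) = 0
    · simp only [h, div_zero, zero_mul, zero_add, add_zero]
      ring
    · have h' : 0 < t' (i + p + 2) - t' (i + 1) :=
        lt_of_le_of_ne (by linarith) (Ne.symm h)
      have hda : t' (i + p + 2) - t' i ≠ 0 := by linarith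
      have heb : t' (i + p + 3) - t' (i + 1) ≠ 0 := by linarith
      have key : (x - t' i) / (t' (i + p + 2) - t' i) * (t' (i + p + 2) - t' k) +
          (t' (i + p + 3) - x) / (t' (i + p + 3) - t' (i + 1)) * (t' k - t' (i + 1)) =
          (t' k - t' i) / (t' (i + p + 2) - t' i) * (t' (i + p + 2) - x) +
          (t' (i + p + 3) - t' k) / (t' (i + p + 3) - t' (i + 1)) * (x - t' (i + 1)) := by
        field_simp
        ring
      linear_combination
        (bspline t' (i + 1) p x / (t' (i + p + 2) - t' (i + 1))) * key

/-- Inserting one knot expresses each B-spline through two consecutive refined B-splines, with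
coefficients independent of the point of evaluation. -/
theorem exists_bspline_eq_of_insert_knot (t t' : ℕ → ℝ) (k M : ℕ)
    (hlt : ∀ j, j < k → t' j = t j)
    (hge : ∀ j, k ≤ j → j ≤ M → t' (j + 1) = t j)
    (hmono : ∀ i j, i ≤ j → j ≤ M + 1 → t' i ≤ t' j)
    (p i : ℕ) (hM : i + p + 1 ≤ M) :
    ∃ a b : ℝ, ∀ x, bspline t i p x = a * bspline t' i p x + b * bspline t' (i + 1) p x := by
  rcases le_or_gt k i with hki | hik
  · refine ⟨0, 1, fun x => ?_⟩
    rw [bspline_congr_shift t t' 1 p i x fun j _ _ => hge j (by omega) (by omega)]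
    ring
  · rcases le_or_gt k (i + p + 1) with hk | hk
    · exact ⟨_, _, fun x => bspline_eq_of_insert_knot t t' k M hlt hge hmono x p i hik hk hM⟩
    · refine ⟨1, 0, fun x => ?_⟩
      rw [bspline_congr_shift t t' 0 p i x fun j _ _ => hlt j (by omega), add_zero]
      ring

/-- let `t = (t_0, …, t_{N+p})` be a knot vector of degree `p` and let
`t'` be the knot vector (of length `N+p+2`) obtained from `t` by inserting one
additional knot `s` with `t_p ≤ s ≤ t_N` (1-based: `t_{p+1} ≤ s ≤ t_{N+1}`), at
position `k`.  Then the spline spaces are nested: every spline in the original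
basis can be written in the refined basis of `N+1` B-splines on `[t_p, t_N)`. -/
theorem bspline_knot_insertion_nested (p N : ℕ) (t t' : ℕ → ℝ) (s : ℝ) (k : ℕ)
    (hmono : ∀ i j, i ≤ j → j ≤ N + p → t i ≤ t j)
    (hknot : ∀ i, i < N → t i < t (i + p + 1))
    (hs1 : t p ≤ s) (hs2 : s ≤ t N)
    (hk : k ≤ N + p)
    (hins1 : ∀ j, j < k → t' j = t j)
    (hins2 : t' k = s)
    (hins3 : ∀ j, k ≤ j → j ≤ N + p → t' (j + 1) = t j)
    (hmono' : ∀ j, j < N + p + 1 → t' j ≤ t' (j + 1)) :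
    ∀ c : ℕ → ℝ, ∃ c' : ℕ → ℝ,
      ∀ x : ℝ, t p ≤ x → x < t N →
        ∑ i ∈ Finset.range N, c i * bspline t i p x
          = ∑ j ∈ Finset.range (N + 1), c' j * bspline t' j p x := by
  intro c
  have mono : ∀ i j, i ≤ j → j ≤ N + p + 1 → t' i ≤ t' j := by
    intro i j hij
    induction j, hij using Nat.le_induction with
    | base => exact fun _ => le_rfl
    | succ j _ ih => exact fun hj => (ih (by omega)).trans (hmono' j (by omega))
  have H : ∀ i, ∃ a b : ℝ, i < N → ∀ x,
      bspline t i p x = a * bspline t' i p x + b * bspline t' (i + 1) p x := by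
    intro i
    by_cases hi : i < N
    · obtain ⟨a, b, h⟩ :=
        exists_bspline_eq_of_insert_knot t t' k (N + p) hins1 hins3 mono p i (by omega)
      exact ⟨a, b, fun _ => h⟩
    · exact ⟨0, 0, fun h => absurd h hi⟩
  choose a b hab using H
  refine ⟨fun j => (if j < N then c j * a j else 0) +
    (if j = 0 then 0 else c (j - 1) * b (j - 1)), fun x _ _ => ?_⟩
  simp only [add_mul, Finset.sum_add_distrib]
  rw [Finset.sum_range_succ, Finset.sum_range_succ' (fun j => (if j = 0 then 0 else _) * _)]
  simp only [lt_irrefl, if_false, if_true, zero_mul, add_zero, Nat.succ_ne_zero,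
    Nat.add_sub_cancel, ← Finset.sum_add_distrib]
  refine Finset.sum_congr rfl fun i hi => ?_
  rw [Finset.mem_range] at hi
  rw [hab i hi x, if_pos hi]
  ring
end
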